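/- Let ε > 0 and let φ₀ : ℝ → [0, 1] be a smooth function supported in [−1, 1] with φ₀ ≡ 1 on [−1/4, 1/4]. Then there exists a constant C > 0, depending only on ε and φ₀, such that for every measurable function A : ℝ → (0, ∞), every Schwartz function f : ℝ → ℂ, and every x ∈ ℝ, | p.v. ∫_ℝ e^{i A(x) |y|^ε} φ₀(A(x)^{1/ε} y) f(x−y) dy/y | ≤ C ( M f(x) + H^* f(x) ). -/

import Mathlib

open MeasureTheory Filter Set
open scoped ENNReal Topology

/-- Principal value integral: the limit, as `δ → 0⁺` and `R → ∞`, of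
`∫_{δ ≤ |y| ≤ R} g(y) dy`. -/
noncomputable def pvIntegral (g : ℝ → ℂ) : ℂ :=
  limUnder ((nhdsWithin (0 : ℝ) (Set.Ioi 0)) ×ˢ Filter.atTop)
    (fun p : ℝ × ℝ => ∫ y in {y : ℝ | p.1 ≤ |y| ∧ |y| ≤ p.2}, g y)

/-- The Hardy–Littlewood maximal function
`M f(x) = sup_{r>0} (1/(2r)) ∫_{|y| ≤ r} |f(x-y)| dy`. -/
noncomputable def maximalFn (f : ℝ → ℂ) (x : ℝ) : ℝ≥0∞ :=
  ⨆ (r : ℝ) (_ : 0 < r),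
    (ENNReal.ofReal (2 * r))⁻¹ * ∫⁻ y in Set.Icc (-r) r, (‖f (x - y)‖₊ : ℝ≥0∞)

/-- The maximal Hilbert transform
`H^* f(x) = sup_{0 < δ < R < ∞} | ∫_{δ < |y| < R} f(x-y) dy/y |`. -/
noncomputable def maxHilbert (f : ℝ → ℂ) (x : ℝ) : ℝ≥0∞ :=
  ⨆ (δ : ℝ) (R : ℝ) (_ : 0 < δ) (_ : δ < R),
    (‖∫ y in {y : ℝ | δ < |y| ∧ |y| < R}, f (x - y) / (y : ℂ)‖₊ : ℝ≥0∞)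


lemma pv_tendsto (h : ℝ → ℂ) (hh : Integrable h) :
    Tendsto (fun p : ℝ × ℝ => ∫ y in {y : ℝ | p.1 ≤ |y| ∧ |y| ≤ p.2}, h y)
      ((nhdsWithin (0 : ℝ) (Set.Ioi 0)) ×ˢ Filter.atTop) (𝓝 (∫ y, h y)) := by
  have hS : ∀ p : ℝ × ℝ, MeasurableSet {y : ℝ | p.1 ≤ |y| ∧ |y| ≤ p.2} := fun p =>
    (measurableSet_le measurable_const measurable_id.abs).inter
      (measurableSet_le measurable_id.abs measurable_const)
  simp_rw [← fun p => integral_indicator (μ := volume) (f := h) (hS p)]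
  refine tendsto_integral_filter_of_dominated_convergence (fun y => ‖h y‖) ?_ ?_ hh.norm ?_
  · exact Eventually.of_forall fun p => hh.aestronglyMeasurable.indicator (hS p)
  · refine Eventually.of_forall fun p => Eventually.of_forall fun y => ?_
    exact norm_indicator_le_norm_self _ _
  · have : ∀ᵐ y : ℝ, y ≠ 0 := by simp [ae_iff]
    filter_upwards [this] with y hy
    refine tendsto_const_nhds.congr' ?_
    have h1 : ∀ᶠ d in nhdsWithin (0 : ℝ) (Set.Ioi 0), d ≤ |y| :=
      nhdsWithin_le_nhds (eventually_le_nhds (abs_pos.mpr hy))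
    have h2 : ∀ᶠ R in (atTop : Filter ℝ), |y| ≤ R := eventually_ge_atTop _
    filter_upwards [h1.prod_mk h2] with p hp
    rw [Set.indicator_of_mem]
    exact hp

lemma dyadic (ε : ℝ) (hε : 0 < ε) (f : ℝ → ℂ) (hf : Continuous f) (x r : ℝ) (hr : 0 < r) :
    ∫⁻ y in Set.Icc (-r) r, ENNReal.ofReal ((|y| / r) ^ ε / |y|) * (‖f (x - y)‖₊ : ℝ≥0∞)
      ≤ (4 * (1 - ENNReal.ofReal ((1/2 : ℝ) ^ ε))⁻¹) * maximalFn f x := by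
  set q : ℝ := (1/2 : ℝ) ^ ε with hq
  have hq0 : 0 < q := by positivity
  have hmf : Measurable fun y => (‖f (x - y)‖₊ : ℝ≥0∞) := by fun_prop
  let T : ℕ → ℝ → ℝ≥0∞ := fun k => (Set.Icc (-((1/2)^k * r)) ((1/2)^k * r)).indicator
    (fun y => ENNReal.ofReal (q^k * 2 / ((1/2)^k * r)) * (‖f (x - y)‖₊ : ℝ≥0∞))
  have hT : ∀ k, Measurable (T k) := fun k =>
    (hmf.const_mul _).indicator measurableSet_Icc
  have hpt : ∀ y ∈ Set.Icc (-r) r,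
      ENNReal.ofReal ((|y| / r) ^ ε / |y|) * (‖f (x - y)‖₊ : ℝ≥0∞) ≤ ∑' k, T k y := by
    intro y hy
    rcases eq_or_ne y 0 with rfl | hy0
    · simp
    have hya : 0 < |y| := abs_pos.mpr hy0
    have hyr : |y| ≤ r := abs_le.mpr hy
    obtain ⟨k, hk1, hk2⟩ := exists_nat_pow_near_of_lt_one (x := |y| / r) (y := (1/2 : ℝ))
      (by positivity) ((div_le_one hr).mpr hyr) (by norm_num) (by norm_num)
    refine le_trans ?_ (ENNReal.le_tsum k)
    have hmem : y ∈ Set.Icc (-((1/2)^k * r)) ((1/2)^k * r) :=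
      abs_le.mp ((div_le_iff₀ hr).mp hk2)
    simp only [T]
    rw [Set.indicator_of_mem hmem]
    refine mul_le_mul_left (ENNReal.ofReal_le_ofReal ?_) _
    rw [mul_div_assoc, div_eq_mul_inv ((|y| / r) ^ ε)]
    apply mul_le_mul _ _ (by positivity) (by positivity)
    · calc (|y| / r) ^ ε ≤ ((1/2 : ℝ)^k) ^ ε := by gcongr
        _ = q ^ k := by
          rw [hq, ← Real.rpow_natCast, ← Real.rpow_natCast, ← Real.rpow_mul (by norm_num),
            ← Real.rpow_mul (by norm_num), mul_comm]
    · rw [inv_eq_one_div, div_le_div_iff₀ hya (by positivity)]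
      rw [lt_div_iff₀ hr, pow_succ] at hk1
      linarith
  have hTk : ∀ k, ∫⁻ y, T k y ≤ 4 * ENNReal.ofReal q ^ k * maximalFn f x := by
    intro k
    simp only [T]
    rw [lintegral_indicator measurableSet_Icc, lintegral_const_mul _ hmf]
    set ρ : ℝ := (1/2)^k * r with hρ
    have hρ0 : 0 < ρ := by positivity
    have hM : (ENNReal.ofReal (2 * ρ))⁻¹ * ∫⁻ y in Set.Icc (-ρ) ρ, (‖f (x - y)‖₊ : ℝ≥0∞)
        ≤ maximalFn f x :=
      le_iSup₂ (f := fun (r : ℝ) (_ : 0 < r) => (ENNReal.ofReal (2 * r))⁻¹ *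
        ∫⁻ y in Set.Icc (-r) r, (‖f (x - y)‖₊ : ℝ≥0∞)) ρ hρ0
    have hM2 : ∫⁻ y in Set.Icc (-ρ) ρ, (‖f (x - y)‖₊ : ℝ≥0∞)
        ≤ ENNReal.ofReal (2 * ρ) * maximalFn f x := by
      rwa [ENNReal.inv_mul_le_iff (by simpa using hρ0) ENNReal.ofReal_ne_top] at hM
    calc _ ≤ ENNReal.ofReal (q^k * 2 / ρ) * (ENNReal.ofReal (2 * ρ) * maximalFn f x) := by gcongr
      _ = _ := by
        rw [← mul_assoc, ← ENNReal.ofReal_mul (by positivity), ← ENNReal.ofReal_pow hq0.le]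
        congr 1
        have : q ^ k * 2 / ρ * (2 * ρ) = 4 * q ^ k := by field_simp; ring
        rw [this, ENNReal.ofReal_mul (by norm_num)]
        norm_num
  calc _ ≤ ∫⁻ y in Set.Icc (-r) r, ∑' k, T k y := setLIntegral_mono' measurableSet_Icc hpt
    _ ≤ ∫⁻ y, ∑' k, T k y := setLIntegral_le_lintegral _ _
    _ = ∑' k, ∫⁻ y, T k y := lintegral_tsum fun k => (hT k).aemeasurable
    _ ≤ ∑' k, 4 * ENNReal.ofReal q ^ k * maximalFn f x := ENNReal.tsum_le_tsum hTk
    _ = _ := by rw [ENNReal.tsum_mul_right, ENNReal.tsum_mul_left, ENNReal.tsum_geometric]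

lemma maximal_lt_top (f : ℝ → ℂ) (B : ℝ) (hB : ∀ y, ‖f y‖ ≤ B) (x : ℝ) :
    maximalFn f x < ∞ := by
  refine lt_of_le_of_lt (b := ENNReal.ofReal B) ?_ ENNReal.ofReal_lt_top
  refine iSup₂_le fun r hr => ?_
  rw [ENNReal.inv_mul_le_iff (by simpa using hr) ENNReal.ofReal_ne_top]
  calc _ ≤ ∫⁻ y in Set.Icc (-r) r, ENNReal.ofReal B := by
        apply lintegral_mono
        intro y
        show ‖f (x - y)‖ₑ ≤ _
        rw [← ofReal_norm]
        exact ENNReal.ofReal_le_ofReal (hB _)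
    _ = _ := by
      rw [setLIntegral_const, Real.volume_Icc, mul_comm]
      congr 2; ring

lemma core (ε : ℝ) (hε : 0 < ε) (K : ℝ) (hK : 0 ≤ K) (f : ℝ → ℂ) (hf : Continuous f)
    (B : ℝ) (hB : ∀ y, ‖f y‖ ≤ B) (Lp : ℝ) (hL : ∀ x y, ‖f x - f y‖ ≤ Lp * |x - y|)
    (x r : ℝ) (hr : 0 < r) (m : ℝ → ℂ) (hm : Measurable m)
    (hm1 : ∀ y, |y| < r → ‖m y - 1‖ ≤ K * (|y| / r) ^ ε)
    (hm2 : ∀ y, |y| = r → ‖m y‖ ≤ K) (hm3 : ∀ y, r < |y| → m y = 0) :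
    (‖pvIntegral (fun y => m y * f (x - y) / (y : ℂ))‖₊ : ℝ≥0∞) ≤
      ENNReal.ofReal K * ((4 * (1 - ENNReal.ofReal ((1/2 : ℝ) ^ ε))⁻¹) * maximalFn f x)
        + maxHilbert f x := by
  have hLp : 0 ≤ Lp := by have := (norm_nonneg _).trans (hL 1 0); simpa using this
  let J : ℝ → ℂ := (Set.Ioo (-r) r).indicator 1
  have hJm : Measurable J := measurable_one.indicator measurableSet_Ioo
  have hfm : Measurable f := hf.measurable
  let E : ℝ → ℂ := fun y => (m y - J y) * f (x - y) / (y : ℂ)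
  let D : ℝ → ℂ := fun y => J y * (f (x - y) - f x) / (y : ℂ)
  let O : ℝ → ℂ := fun y => J y * f x / (y : ℂ)
  have hEm : Measurable E := by fun_prop
  have hDm : Measurable D := by fun_prop
  have hOm : Measurable O := by fun_prop
  have hmJ : ∀ y ∈ Set.Icc (-r) r, ‖m y - J y‖ ≤ K * (|y| / r) ^ ε := by
    intro y hy
    rcases (abs_le.mpr hy).lt_or_eq with h | h
    · have : J y = 1 := Set.indicator_of_mem (s := Set.Ioo (-r) r) (abs_lt.mp h) _
      rw [this]; exact hm1 y h
    · have : J y = 0 := Set.indicator_of_notMem (s := Set.Ioo (-r) r) (fun h' => (abs_lt.mpr h').ne h) _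
      rw [this, h, div_self hr.ne']; simpa using hm2 y h
  have hmJ0 : ∀ y, y ∉ Set.Icc (-r) r → m y - J y = 0 := by
    intro y hy
    have h1 : r < |y| := by
      by_contra h; exact hy (abs_le.mp (not_lt.mp h))
    have : J y = 0 := Set.indicator_of_notMem (fun h' => hy (Ioo_subset_Icc_self h')) _
    rw [this, hm3 y h1, sub_zero]
  have hEle : ∫⁻ y, ‖E y‖ₑ ≤
      ENNReal.ofReal K * ((4 * (1 - ENNReal.ofReal ((1/2 : ℝ) ^ ε))⁻¹) * maximalFn f x) := by
    calc ∫⁻ y, ‖E y‖ₑ = ∫⁻ y in Set.Icc (-r) r, ‖E y‖ₑ := by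
          rw [← lintegral_indicator measurableSet_Icc]
          congr 1; ext y
          by_cases hy : y ∈ Set.Icc (-r) r
          · rw [Set.indicator_of_mem hy]
          · rw [Set.indicator_of_notMem hy]; simp [E, hmJ0 y hy]
      _ ≤ ∫⁻ y in Set.Icc (-r) r, ENNReal.ofReal K *
            (ENNReal.ofReal ((|y| / r) ^ ε / |y|) * (‖f (x - y)‖₊ : ℝ≥0∞)) := by
          refine setLIntegral_mono' measurableSet_Icc fun y hy => ?_
          show _ ≤ _ * (_ * ‖f (x - y)‖ₑ)
          rw [← ofReal_norm, ← ofReal_norm, ← ENNReal.ofReal_mul (by positivity),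
            ← ENNReal.ofReal_mul hK]
          apply ENNReal.ofReal_le_ofReal
          simp only [E, norm_div, norm_mul, Complex.norm_real, Real.norm_eq_abs]
          calc _ ≤ (K * (|y| / r) ^ ε) * ‖f (x - y)‖ / |y| := by
                gcongr; exact hmJ y hy
            _ = _ := by ring
      _ ≤ _ := by
          rw [lintegral_const_mul' _ _ ENNReal.ofReal_ne_top]
          gcongr
          exact dyadic ε hε f hf x r hr
  have hEi : Integrable E := by
    refine ⟨hEm.aestronglyMeasurable, lt_of_le_of_lt hEle ?_⟩
    refine ENNReal.mul_lt_top ENNReal.ofReal_lt_top (ENNReal.mul_lt_top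
      (ENNReal.mul_lt_top (by simp) ?_) (maximal_lt_top f B hB x))
    rw [ENNReal.inv_lt_top, tsub_pos_iff_lt, ENNReal.ofReal_lt_one]
    exact Real.rpow_lt_one (by norm_num) (by norm_num) hε
  have hJ1 : ∀ y, ‖J y‖ ≤ 1 := fun y => by
    refine (norm_indicator_le_norm_self _ _).trans ?_
    simp
  have hDi : Integrable D := by
    have : Integrable ((Set.Ioo (-r) r).indicator fun _ : ℝ => Lp) := by
      rw [integrable_indicator_iff measurableSet_Ioo]
      exact integrableOn_const (by simp)
    refine this.mono' hDm.aestronglyMeasurable (Eventually.of_forall fun y => ?_)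
    by_cases hy : y ∈ Set.Ioo (-r) r
    · rw [Set.indicator_of_mem hy]
      simp only [D, norm_div, norm_mul, Complex.norm_real, Real.norm_eq_abs]
      apply div_le_of_le_mul₀ (abs_nonneg _) hLp
      have := hL (x - y) x
      rw [show x - y - x = -y by ring, abs_neg] at this
      calc _ ≤ 1 * (Lp * |y|) := by gcongr; exact hJ1 y
        _ = _ := one_mul _
    · have : J y = 0 := Set.indicator_of_notMem hy _
      rw [Set.indicator_of_notMem hy]; simp [D, this]
  let S : ℝ × ℝ → Set ℝ := fun p => {y : ℝ | p.1 ≤ |y| ∧ |y| ≤ p.2}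
  have hS : ∀ p : ℝ × ℝ, MeasurableSet (S p) := fun p =>
    (measurableSet_le measurable_const measurable_id.abs).inter
      (measurableSet_le measurable_id.abs measurable_const)
  have hO0 : ∀ p, ∫ y in S p, O y = 0 := by
    intro p
    rw [← integral_indicator (hS p)]
    have h1 := integral_neg_eq_self ((S p).indicator O) volume
    have h2 : (fun y => (S p).indicator O (-y)) = fun y => -((S p).indicator O y) := by
      ext y
      have hJ : J (-y) = J y := by
        simp only [J, Set.indicator, Set.mem_Ioo, ← abs_lt, abs_neg]; rfl
      simp only [Set.indicator, S, Set.mem_ofPred_eq, abs_neg]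
      split_ifs
      · simp only [O, hJ]; push_cast; rw [div_neg]
      · simp
    rw [h2, integral_neg] at h1
    exact self_eq_neg.mp h1.symm
  have hOi : ∀ p : ℝ × ℝ, 0 < p.1 → IntegrableOn O (S p) := by
    intro p hp
    have hfin : volume (S p) < ∞ := by
      refine lt_of_le_of_lt (measure_mono (t := Set.Icc (-p.2) p.2) ?_) (by simp)
      intro y hy; exact abs_le.mp hy.2
    refine Measure.integrableOn_of_bounded (M := ‖f x‖ / p.1) hfin.ne hOm.aestronglyMeasurable ?_
    refine (ae_restrict_iff' (hS p)).mpr (Eventually.of_forall fun y hy => ?_)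
    simp only [O, norm_div, norm_mul, Complex.norm_real, Real.norm_eq_abs]
    have h1 := hJ1 y
    have h2 : p.1 ≤ |y| := hy.1
    calc _ ≤ 1 * ‖f x‖ / p.1 := by gcongr
      _ = _ := by rw [one_mul]
  have hdec : ∀ y, m y * f (x - y) / (y : ℂ) = E y + (D y + O y) := by
    intro y; simp only [E, D, O]; ring
  have hpos : ∀ᶠ p : ℝ × ℝ in (nhdsWithin (0 : ℝ) (Set.Ioi 0)) ×ˢ Filter.atTop,
      (0 < p.1 ∧ p.1 < r) ∧ r < p.2 := by
    have h1 : ∀ᶠ d in nhdsWithin (0 : ℝ) (Set.Ioi 0), 0 < d ∧ d < r :=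
      Ioo_mem_nhdsGT hr
    exact h1.prod_mk (eventually_gt_atTop r)
  have hF : ∀ p : ℝ × ℝ, 0 < p.1 → ∫ y in S p, m y * f (x - y) / (y : ℂ) =
      ∫ y in S p, (E y + D y) := by
    intro p hp
    simp_rw [hdec, ← add_assoc]
    have := integral_add (hEi.add hDi).integrableOn (hOi p hp)
    rw [hO0, add_zero] at this
    exact this
  have hlim : Tendsto (fun p : ℝ × ℝ => ∫ y in S p, m y * f (x - y) / (y : ℂ))
      ((nhdsWithin (0 : ℝ) (Set.Ioi 0)) ×ˢ Filter.atTop) (𝓝 (∫ y, (E y + D y))) := by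
    refine (pv_tendsto _ (hEi.add hDi)).congr' ?_
    filter_upwards [hpos] with p hp
    exact (hF p hp.1.1).symm
  have hpv : pvIntegral (fun y => m y * f (x - y) / (y : ℂ)) = ∫ y, (E y + D y) :=
    hlim.limUnder_eq
  rw [hpv]
  refine le_of_tendsto (hlim.enorm) ?_
  filter_upwards [hpos] with p hp
  obtain ⟨⟨hp0, hp1⟩, hp2⟩ := hp
  simp_rw [hdec]
  have hsplit : ∫ y in S p, (E y + (D y + O y)) = (∫ y in S p, E y) + ∫ y in S p, (D y + O y) :=
    integral_add hEi.integrableOn (hDi.integrableOn.add (hOi p hp0))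
  rw [hsplit]
  refine (enorm_add_le _ _).trans (add_le_add ?_ ?_)
  · refine (enorm_integral_le_lintegral_enorm _).trans ?_
    exact (setLIntegral_le_lintegral _ _).trans hEle
  · have hset : ∫ y in S p, (D y + O y) =
        ∫ y in {y : ℝ | p.1 < |y| ∧ |y| < r}, f (x - y) / (y : ℂ) := by
      have hS2 : MeasurableSet {y : ℝ | p.1 < |y| ∧ |y| < r} :=
        (measurableSet_lt measurable_const measurable_id.abs).inter
          (measurableSet_lt measurable_id.abs measurable_const)
      rw [← integral_indicator (hS p), ← integral_indicator hS2]
      apply integral_congr_ae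
      have h1 : ∀ᵐ y : ℝ, y ≠ p.1 := by simp [ae_iff]
      have h2 : ∀ᵐ y : ℝ, y ≠ -p.1 := by simp [ae_iff]
      filter_upwards [h1, h2] with y hy1 hy2
      have hne : |y| ≠ p.1 := fun h => by
        rcases (abs_eq hp0.le).mp h with h | h
        · exact hy1 h
        · exact hy2 h
      have hDO : D y + O y = J y * (f (x - y) / (y : ℂ)) := by
        simp only [D, O]; ring
      simp only [Set.indicator, S, Set.mem_ofPred_eq, hDO, J, Set.mem_Ioo, ← abs_lt]
      by_cases a : p.1 < |y|
      · by_cases b : |y| < r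
        · simp [a, b, a.le, (b.trans hp2).le]
        · simp [b]
      · have : ¬ p.1 ≤ |y| := fun h => a (lt_of_le_of_ne h hne.symm)
        simp [a, this]
    rw [hset]
    exact le_iSup₂_of_le p.1 r (le_iSup₂_of_le hp0 hp1 le_rfl)

theorem stmt_9 (ε : ℝ) (hε : 0 < ε) (φ₀ : ℝ → ℝ)
    (hφsmooth : ContDiff ℝ (⊤ : ℕ∞) φ₀) (hφrange : ∀ y, φ₀ y ∈ Set.Icc (0 : ℝ) 1)
    (hφsupp : ∀ y, φ₀ y ≠ 0 → y ∈ Set.Icc (-1 : ℝ) 1)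
    (hφone : ∀ y ∈ Set.Icc (-(1/4) : ℝ) (1/4), φ₀ y = 1) :
    ∃ C : ℝ, 0 < C ∧ ∀ A : ℝ → ℝ, Measurable A → (∀ x, 0 < A x) →
      ∀ f : SchwartzMap ℝ ℂ, ∀ x : ℝ,
        (‖pvIntegral (fun y =>
            Complex.exp (Complex.I * (A x : ℂ) * ((|y| ^ ε : ℝ) : ℂ)) *
              ((φ₀ ((A x) ^ (1 / ε) * y) : ℝ) : ℂ) * f (x - y) / (y : ℂ))‖₊ : ℝ≥0∞)
          ≤ ENNReal.ofReal C *
            (maximalFn (fun y => f y) x + maxHilbert (fun y => f y) x) := by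
  set K : ℝ := 1 + 4 ^ ε with hKdef
  have h4 : (0 : ℝ) < 4 ^ ε := by positivity
  have hK : 0 ≤ K := by positivity
  set Q : ℝ≥0∞ := 4 * (1 - ENNReal.ofReal ((1/2 : ℝ) ^ ε))⁻¹ with hQ
  have hQtop : Q ≠ ∞ := by
    refine (ENNReal.mul_lt_top (by simp) ?_).ne
    rw [ENNReal.inv_lt_top, tsub_pos_iff_lt, ENNReal.ofReal_lt_one]
    exact Real.rpow_lt_one (by norm_num) (by norm_num) hε
  refine ⟨K * Q.toReal + 1, by positivity, fun A _ hA f x => ?_⟩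
  have hφc : Continuous φ₀ := hφsmooth.continuous
  set a := A x with ha
  have ha0 : 0 < a := hA x
  set l : ℝ := a ^ (1 / ε) with hl
  have hl0 : 0 < l := by positivity
  have hlε : l ^ ε = a := by
    rw [hl, ← Real.rpow_mul ha0.le, one_div, inv_mul_cancel₀ hε.ne', Real.rpow_one]
  let m : ℝ → ℂ := fun y => Complex.exp (Complex.I * (a : ℂ) * ((|y| ^ ε : ℝ) : ℂ)) *
    ((φ₀ (l * y) : ℝ) : ℂ)
  have hphase : ∀ y, Complex.I * (a : ℂ) * ((|y| ^ ε : ℝ) : ℂ) =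
      Complex.I * (((l * |y|) ^ ε : ℝ) : ℂ) := by
    intro y
    rw [Real.mul_rpow hl0.le (abs_nonneg _), hlε]; push_cast; ring
  have hdiv : ∀ y, |y| / l⁻¹ = l * |y| := fun y => by rw [div_inv_eq_mul, mul_comm]
  have hexp : ∀ t : ℝ, ‖Complex.exp (Complex.I * (t : ℂ))‖ = 1 := fun t => by
    rw [mul_comm]; exact Complex.norm_exp_ofReal_mul_I t
  have hφ1 : ∀ t, |φ₀ t| ≤ 1 := fun t => abs_le.mpr ⟨by linarith [(hφrange t).1], (hφrange t).2⟩
  have hmc : Measurable m := by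
    have : Measurable φ₀ := hφc.measurable
    have h2 : Measurable fun y : ℝ => |y| ^ ε := measurable_id.abs.pow_const ε
    fun_prop
  obtain ⟨B, hB⟩ := f.decay 0 0
  obtain ⟨Lp, hLp⟩ := f.decay 0 1
  have hLp0 : 0 ≤ Lp := hLp.1.le
  have hB' : ∀ y, ‖f y‖ ≤ B := fun y => by simpa using hB.2 y
  have hLip : ∀ u v, ‖f u - f v‖ ≤ Lp * |u - v| := by
    intro u v
    have := Convex.norm_image_sub_le_of_norm_deriv_le (𝕜 := ℝ) (f := f) (C := Lp) (s := Set.univ)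
      (x := v) (y := u) (fun z _ => f.differentiableAt)
      (fun z _ => by
        have := hLp.2 z
        rw [norm_iteratedFDeriv_eq_norm_iteratedDeriv] at this
        simpa using this) convex_univ trivial trivial
    simpa using this
  have key := core ε hε K hK (fun y => f y) f.continuous B hB' Lp hLip x l⁻¹ (by positivity) m hmc
    ?_ ?_ ?_
  · refine key.trans ?_
    rw [mul_add]
    have e1 : ENNReal.ofReal K * (Q * maximalFn (fun y => f y) x) =
        ENNReal.ofReal (K * Q.toReal) * maximalFn (fun y => f y) x := by
      rw [ENNReal.ofReal_mul hK, ENNReal.ofReal_toReal hQtop]; exact (mul_assoc _ _ _).symm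
    rw [e1]
    refine add_le_add ?_ ?_
    · gcongr; linarith
    · refine le_mul_of_one_le_left (by simp) ?_
      rw [ENNReal.one_le_ofReal]
      have : 0 ≤ K * Q.toReal := by positivity
      linarith
  · intro y hy
    rw [hdiv]
    simp only [m]
    rw [hphase]
    set t := l * |y| with ht
    have ht0 : 0 ≤ t := by positivity
    have h1 : ‖Complex.exp (Complex.I * ((t ^ ε : ℝ) : ℂ)) - 1‖ ≤ t ^ ε := by
      refine (Real.norm_exp_I_mul_ofReal_sub_one_le).trans ?_
      rw [Real.norm_eq_abs, abs_of_nonneg (by positivity)]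
    have habs : |l * y| = t := by rw [abs_mul, abs_of_pos hl0]
    have h2 : |φ₀ (l * y) - 1| ≤ 4 ^ ε * t ^ ε := by
      by_cases h : t ≤ 1/4
      · rw [hφone _ (abs_le.mp (habs.trans_le h))]
        simp; positivity
      · rw [← Real.mul_rpow (by norm_num) ht0]
        have : (1:ℝ) ≤ (4 * t) ^ ε := Real.one_le_rpow (by linarith) hε.le
        refine le_trans ?_ this
        rw [abs_le]; constructor <;> linarith [(hφrange (l * y)).1, (hφrange (l * y)).2]
    calc _ = ‖Complex.exp (Complex.I * ((t ^ ε : ℝ) : ℂ)) * ((φ₀ (l * y) - 1 : ℝ) : ℂ) +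
          (Complex.exp (Complex.I * ((t ^ ε : ℝ) : ℂ)) - 1)‖ := by
            congr 1; push_cast; ring
      _ ≤ 1 * (4 ^ ε * t ^ ε) + t ^ ε := by
        refine (norm_add_le _ _).trans (add_le_add ?_ h1)
        rw [norm_mul, hexp, Complex.norm_real, Real.norm_eq_abs]
        gcongr
      _ = _ := by rw [hKdef]; ring
  · intro y _
    simp only [m]
    rw [hphase, norm_mul, hexp, Complex.norm_real, Real.norm_eq_abs]
    linarith [hφ1 (l * y)]
  · intro y hy
    have : φ₀ (l * y) = 0 := by
      by_contra h
      have := abs_le.mpr (hφsupp _ h)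
      rw [abs_mul, abs_of_pos hl0] at this
      rw [inv_lt_iff_one_lt_mul₀ hl0] at hy
      linarith
    simp [m, this]
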